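/- (Corollary 3.2, exactness of observed-information weights under proportional overrunning.) Let (Ω, μ) be a probability space, let T : Ω → ℝ and Y : Ω → ℝ be random variables with T > 0 almost surely, let W : Ω → 𝒲 be a measurable map into a measurable space 𝒲 such that T is σ(W)-measurable (W represents the full sequential data (T, X)), and let c > 0 be a constant. Fix δ₀ ∈ ℝ and suppose: (i) P₁ := p₁(W; δ₀) takes values in (0,1), is σ(W)-measurable, and is uniformly distributed on (0,1) under μ; and (ii) the conditional distribution of Y given W under μ is the Gaussian measure with mean δ₀·c·T and variance c·T. Then the combined p-value with observed-information weights, P = Φ̄( (√T · z(P₁) + Y − δ₀·c·T) / √(T + c·T) ), is uniformly distributed on (0,1) under μ. -/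

import Mathlib

open MeasureTheory ProbabilityTheory Set

/-- The cumulative distribution function `Φ` of the standard Gaussian measure on `ℝ`. -/
noncomputable def stdGaussCDF (x : ℝ) : ℝ := ((gaussianReal 0 1) (Set.Iic x)).toReal

/-- The survival function `Φ̄ = 1 - Φ` of the standard Gaussian measure. -/
noncomputable def stdGaussSurv (x : ℝ) : ℝ := 1 - stdGaussCDF x

/-- `z(u) = Φ̄⁻¹(u)`, the inverse of the standard Gaussian survival function. -/
noncomputable def zval : ℝ → ℝ := Function.invFun stdGaussSurv

/-- The uniform distribution on `(0,1)`: Lebesgue measure restricted to `(0,1)`. -/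
noncomputable def unif01 : Measure ℝ := volume.restrict (Set.Ioo (0 : ℝ) 1)

theorem cdf_eq' (x : ℝ) : stdGaussCDF x = cdf (gaussianReal 0 1) x := by
  rw [cdf_eq_real]; rfl

theorem surv_cont : Continuous stdGaussSurv := by
  have h : Continuous (fun x => cdf (gaussianReal 0 1) x) := by
    rw [continuous_iff_continuousAt]
    intro a
    have hm := (cdf (gaussianReal 0 1)).mono
    refine hm.continuousAt_iff_leftLim_eq_rightLim.2 ?_
    rw [StieltjesFunction.rightLim_eq]
    have h1 := (cdf (gaussianReal 0 1)).measure_singleton a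
    have : NullSingletonClass (gaussianReal 0 1) := nullSingletonClass_gaussianReal one_ne_zero
    rw [measure_cdf, measure_singleton] at h1
    have h2 := ENNReal.ofReal_eq_zero.1 h1.symm
    have h3 := hm.leftLim_le (le_refl a)
    linarith
  unfold stdGaussSurv
  simp_rw [cdf_eq']
  fun_prop

theorem surv_anti : StrictAnti stdGaussSurv := by
  intro x y hxy
  have h1 := (cdf (gaussianReal 0 1)).measure_Ioc x y
  rw [measure_cdf] at h1
  have h2 : gaussianReal 0 1 (Ioc x y) ≠ 0 := by
    intro h0
    have := gaussianReal_absolutelyContinuous' 0 (one_ne_zero) h0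
    simp at this
    linarith
  have h3 : 0 < cdf (gaussianReal 0 1) y - cdf (gaussianReal 0 1) x := by
    by_contra h
    exact h2 (h1.trans (ENNReal.ofReal_eq_zero.2 (not_lt.1 h)))
  simp only [stdGaussSurv, cdf_eq']
  linarith

theorem surv_surj {u : ℝ} (hu : u ∈ Ioo (0:ℝ) 1) : ∃ x, stdGaussSurv x = u := by
  refine mem_range_of_exists_le_of_exists_ge surv_cont ?_ ?_
  · obtain ⟨a, ha⟩ := ((tendsto_cdf_atTop (gaussianReal 0 1)).eventually
      (lt_mem_nhds (show 1 - u < 1 by linarith [hu.1]))).exists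
    exact ⟨a, by simp only [stdGaussSurv, cdf_eq']; linarith⟩
  · obtain ⟨a, ha⟩ := ((tendsto_cdf_atBot (gaussianReal 0 1)).eventually
      (gt_mem_nhds (show 0 < 1 - u by linarith [hu.2]))).exists
    exact ⟨a, by simp only [stdGaussSurv, cdf_eq']; linarith⟩

theorem surv_meas (x : ℝ) : gaussianReal 0 1 (Ici x) = ENNReal.ofReal (stdGaussSurv x) := by
  have : NullSingletonClass (gaussianReal 0 1) := nullSingletonClass_gaussianReal one_ne_zero
  rw [← measure_congr Ioi_ae_eq_Ici, ← compl_Iic, prob_compl_eq_one_sub measurableSet_Iic]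
  rw [stdGaussSurv, cdf_eq', ENNReal.ofReal_sub _ (cdf_nonneg _ _), ofReal_cdf, ENNReal.ofReal_one]

theorem surv_mem (x : ℝ) : stdGaussSurv x ∈ Icc (0:ℝ) 1 := by
  simp only [stdGaussSurv, cdf_eq']
  constructor
  · linarith [cdf_le_one (gaussianReal 0 1) x]
  · linarith [cdf_nonneg (gaussianReal 0 1) x]

theorem surv_map : (gaussianReal 0 1).map stdGaussSurv = unif01 := by
  have : IsProbabilityMeasure ((gaussianReal 0 1).map stdGaussSurv) :=
    Measure.isProbabilityMeasure_map surv_cont.measurable.aemeasurable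
  refine Measure.ext_of_Iic _ _ fun u => ?_
  rw [Measure.map_apply surv_cont.measurable measurableSet_Iic, unif01,
    Measure.restrict_apply measurableSet_Iic]
  rcases le_or_gt u 0 with h0 | h0
  · have e1 : Iic u ∩ Ioo (0:ℝ) 1 = ∅ := by
      ext v; simp only [mem_inter_iff, mem_Iic, mem_Ioo, mem_empty_iff_false, iff_false]
      rintro ⟨a, b, _⟩; linarith
    have e2 : stdGaussSurv ⁻¹' Iic u = ∅ := by
      ext v; simp only [mem_preimage, mem_Iic, mem_empty_iff_false, iff_false, not_le]
      have := surv_anti (show v < v + 1 by linarith)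
      linarith [(surv_mem (v+1)).1]
    rw [e1, e2]; simp
  rcases le_or_gt 1 u with h1 | h1
  · have e1 : Iic u ∩ Ioo (0:ℝ) 1 = Ioo 0 1 := by
      ext v; simp only [mem_inter_iff, mem_Iic, mem_Ioo, and_iff_right_iff_imp]
      rintro ⟨a, b⟩; linarith
    have e2 : stdGaussSurv ⁻¹' Iic u = univ := by
      ext v; simp only [mem_preimage, mem_Iic, mem_univ, iff_true]
      linarith [(surv_mem v).2]
    rw [e1, e2]; simp
  · obtain ⟨x, hx⟩ := surv_surj ⟨h0, h1⟩
    have e1 : Iic u ∩ Ioo (0:ℝ) 1 = Ioc 0 u := by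
      ext v; simp only [mem_inter_iff, mem_Iic, mem_Ioo, mem_Ioc]
      constructor
      · rintro ⟨a, b, _⟩; exact ⟨b, a⟩
      · rintro ⟨a, b⟩; exact ⟨b, a, by linarith⟩
    have e2 : stdGaussSurv ⁻¹' Iic u = Ici x := by
      ext v; simp only [mem_preimage, mem_Iic, mem_Ici, ← hx]
      exact surv_anti.le_iff_ge
    rw [e1, e2, surv_meas, hx]; simp

theorem zval_surv (x : ℝ) : zval (stdGaussSurv x) = x :=
  Function.leftInverse_invFun surv_anti.injective x

theorem exists_zmeas : ∃ g : ℝ → ℝ, Measurable g ∧ (∀ x, g (stdGaussSurv x) = x) ∧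
    ∀ u ∈ Ioo (0:ℝ) 1, g u = zval u := by
  obtain ⟨g, hg, h⟩ := (surv_cont.measurableEmbedding
    surv_anti.injective).exists_measurable_extend measurable_id (fun _ => ⟨(0:ℝ)⟩)
  refine ⟨g, hg, fun x => congrFun h x, fun u hu => ?_⟩
  obtain ⟨x, rfl⟩ := surv_surj hu
  rw [zval_surv]; exact congrFun h x

theorem comb_law (c : ℝ) (hc : 0 < c) :
    ((gaussianReal 0 1).prod (gaussianReal 0 1)).map
      (fun p : ℝ × ℝ => (p.1 + Real.sqrt c * p.2) / Real.sqrt (1 + c)) = gaussianReal 0 1 := by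
  have e : (fun p : ℝ × ℝ => (p.1 + Real.sqrt c * p.2) / Real.sqrt (1 + c)) =
      (fun x => x / Real.sqrt (1 + c)) ∘ (fun p : ℝ × ℝ => p.1 + p.2) ∘
        (Prod.map id (fun x => Real.sqrt c * x)) := rfl
  rw [e, ← Measure.map_map (by fun_prop) (by fun_prop),
    ← Measure.map_map (by fun_prop) (by fun_prop),
    ← Measure.map_prod_map _ _ (by fun_prop) (by fun_prop), Measure.map_id,
    gaussianReal_map_const_mul]
  have h := @gaussianReal_conv_gaussianReal 0 (Real.sqrt c * 0) 1
    (.mk (Real.sqrt c ^ 2) (sq_nonneg _) * 1)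
  rw [Measure.conv] at h
  rw [h, gaussianReal_map_div_const]
  congr 1
  · simp
  · ext
    have h1 : (0:ℝ) ≤ c := hc.le
    have h2 : (0:ℝ) ≤ 1 + c := by linarith
    have h3 : (1 + c) ≠ 0 := by linarith
    simp [Real.sq_sqrt, h1, h2, h3]

theorem std_law (m v : ℝ) (hv : 0 < v) :
    (gaussianReal m v.toNNReal).map (fun y => (y - m) / Real.sqrt v) = gaussianReal 0 1 := by
  have e : (fun y => (y - m) / Real.sqrt v) =
    (fun x => x / Real.sqrt v) ∘ (fun y => y - m) := rfl
  rw [e, ← Measure.map_map (by fun_prop) (by fun_prop), gaussianReal_map_sub_const,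
    gaussianReal_map_div_const]
  congr 1
  · simp
  · ext
    simp [Real.sq_sqrt, hv.le, hv.ne']

theorem stmt12 {Ω 𝒲 : Type*} [MeasurableSpace Ω] [MeasurableSpace 𝒲]
    (μ : Measure Ω) [IsProbabilityMeasure μ]
    (W : Ω → 𝒲) (hW : Measurable W)
    (T : Ω → ℝ) (hTm : Measurable[MeasurableSpace.comap W inferInstance] T)
    (hTpos : ∀ᵐ ω ∂μ, 0 < T ω)
    (Y : Ω → ℝ) (hY : Measurable Y)
    (c : ℝ) (hc : 0 < c) (δ₀ : ℝ)
    (P₁ : Ω → ℝ)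
    (hP₁m : Measurable[MeasurableSpace.comap W inferInstance] P₁)
    (hP₁val : ∀ ω, P₁ ω ∈ Set.Ioo (0 : ℝ) 1)
    (hP₁unif : μ.map P₁ = unif01)
    (hcond : ∀ᵐ ω ∂μ,
      condDistrib Y W μ (W ω) = gaussianReal (δ₀ * (c * T ω)) (Real.toNNReal (c * T ω))) :
    μ.map (fun ω => stdGaussSurv
      ((Real.sqrt (T ω) * zval (P₁ ω) + Y ω - δ₀ * (c * T ω)) /
        Real.sqrt (T ω + c * T ω))) = unif01 := by
  obtain ⟨T', hT', rfl⟩ := hTm.exists_eq_measurable_comp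
  obtain ⟨p, hp, rfl⟩ := hP₁m.exists_eq_measurable_comp
  obtain ⟨g, hg, hg1, hg2⟩ := exists_zmeas
  simp only [Function.comp_apply] at *
  set K : 𝒲 × ℝ → ℝ × ℝ := fun q =>
    (g (p q.1), (q.2 - δ₀ * (c * T' q.1)) / Real.sqrt (c * T' q.1)) with hK
  have hKm : Measurable K := by
    rw [hK]; fun_prop
  have hZ : μ.map (fun ω => g (p (W ω))) = gaussianReal 0 1 := by
    have : (fun ω => g (p (W ω))) = g ∘ (p ∘ W) := rfl
    rw [this, ← Measure.map_map hg (hp.comp hW), hP₁unif, ← surv_map,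
      Measure.map_map hg surv_cont.measurable]
    have : g ∘ stdGaussSurv = id := funext hg1
    rw [this, Measure.map_id]
  have joint : μ.map (fun ω => K (W ω, Y ω)) = (gaussianReal 0 1).prod (gaussianReal 0 1) := by
    ext A hA
    have e : (fun ω => K (W ω, Y ω)) = K ∘ (fun ω => (W ω, Y ω)) := rfl
    rw [e, ← Measure.map_map hKm (hW.prodMk hY), ← compProd_map_condDistrib hY.aemeasurable,
      Measure.map_apply hKm hA, Measure.compProd_apply (hKm hA),
      lintegral_map (Kernel.measurable_kernel_prodMk_left (hKm hA)) hW,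
      Measure.prod_apply hA]
    have hr : ∫⁻ x, gaussianReal 0 1 (Prod.mk x ⁻¹' A) ∂(gaussianReal 0 1) =
        ∫⁻ ω, gaussianReal 0 1 (Prod.mk (g (p (W ω))) ⁻¹' A) ∂μ := by
      rw [← lintegral_map (f := fun x => gaussianReal 0 1 (Prod.mk x ⁻¹' A))
        (g := fun ω => g (p (W ω))) (measurable_measure_prodMk_left hA)
        (hg.comp (hp.comp hW)), hZ]
    rw [hr]
    refine lintegral_congr_ae ?_
    filter_upwards [hcond, hTpos] with ω h1 h2
    rw [h1]
    conv_rhs => rw [← std_law (δ₀ * (c * T' (W ω))) (c * T' (W ω)) (by positivity)]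
    rw [Measure.map_apply (by fun_prop) (measurable_prodMk_left hA)]
    rfl
  have hS : Measurable (fun q : ℝ × ℝ =>
      stdGaussSurv ((q.1 + Real.sqrt c * q.2) / Real.sqrt (1 + c))) :=
    surv_cont.measurable.comp (by fun_prop)
  have hae : (fun ω => stdGaussSurv
      ((Real.sqrt (T' (W ω)) * zval (p (W ω)) + Y ω - δ₀ * (c * T' (W ω))) /
        Real.sqrt (T' (W ω) + c * T' (W ω)))) =ᵐ[μ]
      (fun q : ℝ × ℝ => stdGaussSurv ((q.1 + Real.sqrt c * q.2) / Real.sqrt (1 + c))) ∘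
        (fun ω => K (W ω, Y ω)) := by
    filter_upwards [hTpos] with ω h
    simp only [Function.comp_apply, hK]
    congr 1
    rw [hg2 _ (hP₁val ω), show T' (W ω) + c * T' (W ω) = T' (W ω) * (1 + c) by ring,
      Real.sqrt_mul h.le, Real.sqrt_mul hc.le]
    have a1 : Real.sqrt (T' (W ω)) ≠ 0 := (Real.sqrt_pos.2 h).ne'
    have a2 : Real.sqrt c ≠ 0 := (Real.sqrt_pos.2 hc).ne'
    have a3 : Real.sqrt (1 + c) ≠ 0 := (Real.sqrt_pos.2 (by linarith)).ne'
    field_simp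
    ring
  rw [Measure.map_congr hae, ← Measure.map_map hS (show Measurable (fun ω => K (W ω, Y ω)) from
    hKm.comp (hW.prodMk hY)), joint]
  have e : (fun q : ℝ × ℝ => stdGaussSurv ((q.1 + Real.sqrt c * q.2) / Real.sqrt (1 + c))) =
    stdGaussSurv ∘ (fun q : ℝ × ℝ => (q.1 + Real.sqrt c * q.2) / Real.sqrt (1 + c)) := rfl
  rw [e, ← Measure.map_map surv_cont.measurable (by fun_prop), comb_law c hc, surv_map]
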